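/- Let H be a separable Hilbert space and F : H → ℝ be continuously Fréchet differentiable with second Gâteaux derivative Hess F : H → L(H) that is continuous from the norm topology on H to the weak-* topology on L(H) = (L₁(H))*. Let V be a separable Hilbert space compactly and densely embedded in H. If u_k ⇀ u weakly in V, then Hess F(u_k) → Hess F(u) in the operator norm of L(V; V'). -/

import Mathlib

open scoped RealInnerProductSpace

/-- A pointwise bounded sequence of functionals `⟪x k, ·⟫` is norm bounded. -/
lemma aux_weak_bdd {V : Type*} [NormedAddCommGroup V] [InnerProductSpace ℝ V] [CompleteSpace V]
    (x : ℕ → V) (h : ∀ v, ∃ C, ∀ k, ‖⟪x k, v⟫‖ ≤ C) : ∃ C, ∀ k, ‖x k‖ ≤ C := by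
  obtain ⟨C, hC⟩ := banach_steinhaus (g := fun k => innerSL ℝ (x k)) (by simpa using h)
  exact ⟨C, fun k => by simpa using hC k⟩

lemma aux_tendsto_bdd {f : ℕ → ℝ} {a : ℝ} (h : Filter.Tendsto f Filter.atTop (nhds a)) :
    ∃ C, ∀ k, ‖f k‖ ≤ C := by
  obtain ⟨C, hC⟩ := (Metric.isBounded_range_of_tendsto f h).exists_norm_le
  exact ⟨C, fun k => hC _ ⟨k, rfl⟩⟩

/-- Compact operators map weakly convergent sequences to norm convergent ones. -/
lemma aux_compact_weak {V H : Type*}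
    [NormedAddCommGroup V] [InnerProductSpace ℝ V] [CompleteSpace V]
    [NormedAddCommGroup H] [InnerProductSpace ℝ H] [CompleteSpace H]
    (i : V →L[ℝ] H) (hcomp : IsCompactOperator i) (uk : ℕ → V) (u : V)
    (hw : ∀ φ : V →L[ℝ] ℝ,
      Filter.Tendsto (fun k => φ (uk k)) Filter.atTop (nhds (φ u))) :
    Filter.Tendsto (fun k => i (uk k)) Filter.atTop (nhds (i u)) := by
  obtain ⟨R, hR⟩ := aux_weak_bdd uk (fun v => by
    obtain ⟨C, hC⟩ := aux_tendsto_bdd (hw (innerSL ℝ v))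
    exact ⟨C, fun k => by simpa [real_inner_comm] using hC k⟩)
  have hK : IsCompact (closure (i '' Metric.closedBall 0 R)) :=
    IsCompactOperator.isCompact_closure_image_closedBall (f := (i : V →ₗ[ℝ] H)) hcomp R
  refine Filter.tendsto_of_subseq_tendsto fun ns hns => ?_
  obtain ⟨y, -, ms, hms, hy⟩ := hK.tendsto_subseq (x := fun n => i (uk (ns n)))
    (fun n => subset_closure ⟨uk (ns n), by simpa using hR _, rfl⟩)
  refine ⟨ms, ?_⟩
  have hyu : y = i u := by
    refine ext_inner_left ℝ fun w => ?_
    have h1 := ((innerSL ℝ w).continuous.tendsto y).comp hy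
    have h2 := (hw ((innerSL ℝ w).comp i)).comp (hns.comp hms.tendsto_atTop)
    exact tendsto_nhds_unique h1 h2
  rw [← hyu]
  exact hy

/-- Weak operator convergence to zero implies norm convergence after compact sandwiching. -/
lemma aux_sandwich {V H : Type*}
    [NormedAddCommGroup V] [InnerProductSpace ℝ V] [CompleteSpace V]
    [NormedAddCommGroup H] [InnerProductSpace ℝ H] [CompleteSpace H]
    (i : V →L[ℝ] H) (hcomp : IsCompactOperator i) (T : ℕ → H →L[ℝ] H)
    (hT : ∀ a b, Filter.Tendsto (fun k => ⟪T k a, b⟫) Filter.atTop (nhds 0)) :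
    Filter.Tendsto (fun k => ‖(ContinuousLinearMap.adjoint i).comp ((T k).comp i)‖)
      Filter.atTop (nhds 0) := by
  obtain ⟨C, hC⟩ := banach_steinhaus (g := T) (fun a =>
    aux_weak_bdd (fun k => T k a) (fun b => aux_tendsto_bdd (hT a b)))
  have hC0 : 0 ≤ C := (norm_nonneg _).trans (hC 0)
  have hK : IsCompact (closure (i '' Metric.closedBall 0 1)) :=
    IsCompactOperator.isCompact_closure_image_closedBall (f := (i : V →ₗ[ℝ] H)) hcomp 1
  set K := closure (i '' Metric.closedBall 0 1) with hKdef
  obtain ⟨M, hM0, hM⟩ := hK.isBounded.exists_pos_norm_le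
  have key : ∀ ε > 0, ∀ᶠ k in Filter.atTop, ∀ a ∈ K, ∀ b ∈ K, |⟪T k a, b⟫| ≤ ε := by
    intro ε hε
    have hd : 0 < 4 * (C + 1) * M := by positivity
    set δ := ε / (4 * (C + 1) * M) with hδ
    have hδ0 : 0 < δ := by positivity
    have hδe : δ * (4 * (C + 1) * M) = ε := div_mul_cancel₀ _ hd.ne'
    obtain ⟨t, htK, htf, htc⟩ := hK.finite_cover_balls hδ0
    have hev : ∀ᶠ k in Filter.atTop, ∀ a ∈ t, ∀ b ∈ t, |⟪T k a, b⟫| < ε / 2 := by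
      rw [Filter.eventually_all_finite htf]
      intro a _
      rw [Filter.eventually_all_finite htf]
      intro b _
      have := (hT a b).abs
      rw [abs_zero] at this
      exact this.eventually_lt_const (by positivity)
    filter_upwards [hev] with k hk a ha b hb
    obtain ⟨ap, hap, haa⟩ := Set.mem_iUnion₂.1 (htc ha)
    obtain ⟨bp, hbp, hbb⟩ := Set.mem_iUnion₂.1 (htc hb)
    rw [Metric.mem_ball, dist_eq_norm] at haa hbb
    have e : ⟪T k a, b⟫ = ⟪T k ap, bp⟫ + ⟪T k (a - ap), b⟫ + ⟪T k ap, b - bp⟫ := by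
      rw [map_sub, inner_sub_left, inner_sub_right]; ring
    have h1 : |⟪T k (a - ap), b⟫| ≤ C * δ * M := by
      refine (abs_real_inner_le_norm _ _).trans ?_
      have := ((T k).le_opNorm (a - ap)).trans
        (mul_le_mul (hC k) haa.le (norm_nonneg _) hC0)
      exact mul_le_mul this (hM b hb) (norm_nonneg _) (by positivity)
    have h2 : |⟪T k ap, b - bp⟫| ≤ C * M * δ := by
      refine (abs_real_inner_le_norm _ _).trans ?_
      have := ((T k).le_opNorm ap).trans
        (mul_le_mul (hC k) (hM ap (htK hap)) (norm_nonneg _) hC0)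
      exact mul_le_mul this hbb.le (norm_nonneg _) (by positivity)
    have h3 := hk ap hap bp hbp
    have h4 : 0 < δ * M := by positivity
    rw [e]
    refine (abs_add_three _ _ _).trans ?_
    nlinarith
  rw [Metric.tendsto_atTop']
  intro ε hε
  obtain ⟨N, hN⟩ := Filter.eventually_atTop.1 (key (ε / 2) (by positivity))
  refine ⟨N, fun k hk => ?_⟩
  rw [dist_zero_right, norm_norm]
  refine lt_of_le_of_lt ?_ (half_lt_self hε)
  have hmem : ∀ v : V, ‖v‖ = 1 → i v ∈ K := fun v hv =>
    subset_closure ⟨v, by simp [hv], rfl⟩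
  refine ContinuousLinearMap.opNorm_le_of_unit_norm (by positivity) fun v hv => ?_
  set w := ((ContinuousLinearMap.adjoint i).comp ((T k).comp i)) v with hw
  by_cases hw0 : w = 0
  · rw [hw0, norm_zero]; positivity
  have hn : ‖w‖ ≠ 0 := norm_ne_zero_iff.2 hw0
  have h := hN k hk.le (i v) (hmem v hv) (i (‖w‖⁻¹ • w))
    (hmem _ (by rw [norm_smul, norm_inv, norm_norm, inv_mul_cancel₀ hn]))
  have e : ⟪T k (i v), i (‖w‖⁻¹ • w)⟫ = ‖w‖ := by
    rw [← ContinuousLinearMap.adjoint_inner_left]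
    change ⟪w, ‖w‖⁻¹ • w⟫ = ‖w‖
    rw [real_inner_smul_right, real_inner_self_eq_norm_sq]
    field_simp
  rw [e] at h
  exact (le_abs_self _).trans h

/-- If `F : H → ℝ` is C¹ with second Gâteaux derivative `Hess F : H → L(H)` bounded on
bounded sets and continuous from the norm topology of `H` into the weak-* (= weak
operator, on bounded sets) topology of `L(H)`, and `V` embeds compactly and densely
into `H` via `i`, then `u_k ⇀ u` weakly in `V` implies `Hess F(u_k) → Hess F(u)` in the
norm of `L(V; V')`; the `L(V;V')`-norm of `B ∈ L(H)` is realized as `‖i* ∘ B ∘ i‖`. -/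
theorem stmt_14 (V H : Type*)
    [NormedAddCommGroup V] [InnerProductSpace ℝ V] [CompleteSpace V]
    [NormedAddCommGroup H] [InnerProductSpace ℝ H] [CompleteSpace H]
    (i : V →L[ℝ] H) (hinj : Function.Injective i) (hdense : DenseRange i)
    (hcomp : IsCompactOperator i)
    (F : H → ℝ) (hF : ContDiff ℝ 1 F)
    (HessF : H → H →L[ℝ] H)
    (hGateaux : ∀ x u : H,
      Filter.Tendsto (fun t : ℝ => t⁻¹ • (gradient F (x + t • u) - gradient F x))
        (nhdsWithin 0 {0}ᶜ) (nhds (HessF x u)))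
    (hbdd : ∀ s : Set H, Bornology.IsBounded s →
      Bornology.IsBounded ((fun x => ‖HessF x‖) '' s))
    (hcont : ∀ (x : H) (xk : ℕ → H), Filter.Tendsto xk Filter.atTop (nhds x) →
      ∀ u v : H, Filter.Tendsto (fun k => ⟪HessF (xk k) u, v⟫) Filter.atTop
        (nhds ⟪HessF x u, v⟫)) :
    ∀ (uk : ℕ → V) (u : V),
      (∀ φ : V →L[ℝ] ℝ, Filter.Tendsto (fun k => φ (uk k)) Filter.atTop (nhds (φ u))) →
      Filter.Tendsto
        (fun k => ‖(ContinuousLinearMap.adjoint i).comp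
          (((HessF (i (uk k)) - HessF (i u)).comp i))‖)
        Filter.atTop (nhds 0) := by
  intro uk u hw
  refine aux_sandwich i hcomp (fun k => HessF (i (uk k)) - HessF (i u)) fun a b => ?_
  have h := (hcont (i u) _ (aux_compact_weak i hcomp uk u hw) a b).sub_const
    ⟪HessF (i u) a, b⟫
  simpa [inner_sub_left] using h
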